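/- arXiv:1703.06711 — 2 statements merged into one kernel-verified Lean document; each statement's English description precedes it below -/
import Mathlib

section
/- There exists a constant C > 0 such that for all y ∈ [-1/2,1/2] and all sufficiently small κγ ≥ 0: |I(y)| ≤ C|sin(πy)|^{1/2}, |J(y)| ≤ C|sin(πy)|^{3/2}, |K(y)| ≤ C|sin(πy)|^{3/2}, and |L(y)| ≤ C|sin(πy)|^{3/2}, where I(y) = ∫_{-1/2}^{1/2} Θ(y-x,x) dx, J(y) = ∫_{-1/2}^{1/2} Θ(y-x,x) e^{-2πix}(1-e^{2πiy}) dx, K(y) = -∫_{-1/2}^{1/2} iΩ(y-x,x)Θ(y-x,x) dx, and L(y) = ∫_{-1/2}^{1/2} (1-e^{-2πix}) Θ(y-x,x) dx. -/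
open Real MeasureTheory

noncomputable def Lam (k l : ℝ) : ℝ := 4 * (Real.sin (π * k) ^ 2 + Real.sin (π * l) ^ 2)

noncomputable def Om (k l : ℝ) : ℝ := 2 * (Real.sin (2 * π * k) + Real.sin (2 * π * l))

noncomputable def Theta (a : ℝ) (k l : ℝ) : ℂ :=
  (Complex.I * ((Om k l : ℝ) : ℂ)) /
    (((1 + a : ℝ) : ℂ) * ((Lam k l : ℝ) : ℂ) - Complex.I * ((Om k l : ℝ) : ℂ))

lemma Om_eq (y x : ℝ) :
    Om (y - x) x = 4 * (Real.sin (π * y) * Real.cos (2 * π * (x - y / 2))) := by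
  have h1 : 2 * π * (y - x) = π * y - 2 * π * (x - y / 2) := by ring
  have h2 : 2 * π * x = π * y + 2 * π * (x - y / 2) := by ring
  unfold Om
  rw [h1, h2, Real.sin_sub, Real.sin_add]; ring

lemma Lam_eq (y x : ℝ) :
    Lam (y - x) x = 4 * (1 - Real.cos (π * y) * Real.cos (2 * π * (x - y / 2))) := by
  have h1 : 2 * (π * (y - x)) = π * y - 2 * π * (x - y / 2) := by ring
  have h2 : 2 * (π * x) = π * y + 2 * π * (x - y / 2) := by ring
  unfold Lam
  rw [Real.sin_sq_eq_half_sub, Real.sin_sq_eq_half_sub, h1, h2, Real.cos_sub, Real.cos_add]; ring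

/-- The denominator, up to the factor 4. -/
noncomputable def Den (b s c v : ℝ) : ℂ :=
  ((b * (1 - c * v) : ℝ) : ℂ) - Complex.I * ((s * v : ℝ) : ℂ)

lemma Theta_eq (a y x : ℝ) :
    Theta a (y - x) x = Complex.I * ((Real.sin (π * y) * Real.cos (2 * π * (x - y / 2)) : ℝ) : ℂ) /
      Den (1 + a) (Real.sin (π * y)) (Real.cos (π * y)) (Real.cos (2 * π * (x - y / 2))) := by
  unfold Theta Den
  rw [Om_eq, Lam_eq]
  have h4 : (4:ℂ) ≠ 0 := by norm_num
  refine Eq.trans ?_ (mul_div_mul_left _ _ h4)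
  congr 1 <;> push_cast <;> ring

lemma den_lower {b s c v : ℝ} (hb : 1 ≤ b) (hs : |s| ≤ 1) (hc0 : 0 ≤ c) (hc : c ≤ 1)
    (hv0 : -1 ≤ v) (hv : v ≤ 1) : |s| + (1 - v) ≤ 8 * ‖Den b s c v‖ := by
  have hre : (Den b s c v).re = b * (1 - c * v) := by simp [Den]
  have him : (Den b s c v).im = -(s * v) := by simp [Den]
  have h1 := Complex.abs_re_le_norm (Den b s c v)
  have h2 := Complex.abs_im_le_norm (Den b s c v)
  rw [hre] at h1
  rw [him, abs_neg, abs_mul] at h2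
  have h3 := le_abs_self (b * (1 - c * v))
  have hcv : c * v ≤ 1 := by nlinarith
  have h4 : 1 - c * v ≤ b * (1 - c * v) := by nlinarith
  rcases le_total v (1/2) with h | h
  · have : c * v ≤ 1 / 2 := by nlinarith
    linarith
  · have : c * v ≤ v := by nlinarith
    have h5 := le_abs_self v
    have h6 : |s| * (1/2) ≤ |s| * |v| := by
      apply mul_le_mul_of_nonneg_left _ (abs_nonneg _); linarith
    linarith

lemma sq_le_one_sub_cos {u : ℝ} (hu : |u| ≤ 1 / 2) : 4 * u ^ 2 ≤ 1 - Real.cos (2 * π * u) := by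
  have h1 : Real.cos (2 * π * u) = 1 - 2 * Real.sin (π * u) ^ 2 := by
    have := Real.sin_sq_eq_half_sub (π * u)
    rw [this]; ring_nf
  have h2 : 2 * |u| ≤ |Real.sin (π * u)| := by
    have := Real.mul_abs_le_abs_sin (x := π * u)
      (by rw [abs_mul, abs_of_pos Real.pi_pos]; nlinarith [Real.pi_pos])
    rw [abs_mul, abs_of_pos Real.pi_pos] at this
    have e : 2 / π * (π * |u|) = 2 * |u| := by field_simp
    linarith
  have h3 : (2 * |u|) ^ 2 ≤ |Real.sin (π * u)| ^ 2 := by gcongr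
  rw [mul_pow, sq_abs, sq_abs] at h3
  rw [h1]; nlinarith [sq_nonneg (Real.sin (π * u))]

lemma int_bound {r : ℝ} (hr : 0 < r) :
    IntervalIntegrable (fun u : ℝ => r ^ 2 / (r ^ 2 + 4 * u ^ 2)) volume (-(1:ℝ)/2) (1/2) ∧
    ∫ u in (-(1:ℝ)/2)..(1/2), r ^ 2 / (r ^ 2 + 4 * u ^ 2) ≤ 2 * r := by
  have hcont : Continuous (fun u : ℝ => r ^ 2 / (r ^ 2 + 4 * u ^ 2)) := by
    apply Continuous.div (by fun_prop) (by fun_prop)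
    intro u; positivity
  have hi : IntervalIntegrable (fun u : ℝ => r ^ 2 / (r ^ 2 + 4 * u ^ 2)) volume (-(1:ℝ)/2) (1/2) :=
    hcont.intervalIntegrable _ _
  refine ⟨hi, ?_⟩
  have hd : ∀ u ∈ Set.uIcc (-(1:ℝ)/2) (1/2),
      HasDerivAt (fun u : ℝ => r / 2 * Real.arctan (2 / r * u)) (r ^ 2 / (r ^ 2 + 4 * u ^ 2)) u := by
    intro u _
    have h := (((hasDerivAt_id u).const_mul (2 / r)).arctan).const_mul (r / 2)
    refine HasDerivAt.congr_deriv (f := fun u : ℝ => r / 2 * Real.arctan (2 / r * u)) h ?_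
    simp only [id]
    field_simp
    ring
  rw [intervalIntegral.integral_eq_sub_of_hasDerivAt hd hi]
  have e1 := Real.arctan_lt_pi_div_two (2 / r * (1 / 2))
  have e2 := Real.neg_pi_div_two_lt_arctan (2 / r * (-1 / 2))
  have := Real.pi_lt_four
  nlinarith

lemma shift_int {E : Type*} [NormedAddCommGroup E] [NormedSpace ℝ E] (f : ℝ → E)
    (hf : Function.Periodic f 1) (y : ℝ) :
    ∫ x in (-(1:ℝ)/2)..(1/2), f (x - y / 2) = ∫ x in (-(1:ℝ)/2)..(1/2), f x := by
  rw [intervalIntegral.integral_comp_sub_right]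
  have := hf.intervalIntegral_add_eq (-(1:ℝ)/2 - y / 2) (-(1:ℝ)/2)
  convert this using 2 <;> ring

lemma odd_int (f : ℝ → ℂ) (hf : ∀ x, f (-x) = - f x) :
    ∫ x in (-(1:ℝ)/2)..(1/2), f x = 0 := by
  have h := intervalIntegral.integral_comp_neg (a := -(1:ℝ)/2) (b := 1/2) f
  simp only [hf, intervalIntegral.integral_neg] at h
  have e1 : -(-(1:ℝ)/2) = 1/2 := by ring
  have e2 : -((1:ℝ)/2) = -1/2 := by ring
  rw [e1, e2] at h
  exact self_eq_neg.mp h.symm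

lemma cos_per (x : ℝ) : Real.cos (2 * π * (x + 1)) = Real.cos (2 * π * x) := by
  rw [mul_add, mul_one, Real.cos_add_two_pi]

lemma sin_per (x : ℝ) : Real.sin (2 * π * (x + 1)) = Real.sin (2 * π * x) := by
  rw [mul_add, mul_one, Real.sin_add_two_pi]

lemma cos_int (y : ℝ) :
    ∫ x in (-(1:ℝ)/2)..(1/2), ((Real.cos (2 * π * (x - y / 2)) : ℝ) : ℂ) = 0 := by
  rw [shift_int (fun u => ((Real.cos (2 * π * u) : ℝ) : ℂ)) (fun x => by simp only [cos_per]) y]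
  rw [intervalIntegral.integral_ofReal]
  rw [intervalIntegral.integral_comp_mul_left (fun x => Real.cos x) (by positivity : 2 * π ≠ 0)]
  rw [integral_cos]
  have e1 : 2 * π * (1 / 2) = π := by ring
  have e2 : 2 * π * (-1 / 2) = -π := by ring
  rw [e1, e2]; simp

lemma Den_ne (a y : ℝ) (ha : 0 ≤ a) (hy : y ∈ Set.Icc (-(1:ℝ)/2) (1/2))
    (hs : Real.sin (π * y) ≠ 0) (u : ℝ) :
    |Real.sin (π * y)| + (1 - Real.cos (2 * π * u)) ≤ 8 *
      ‖Den (1 + a) (Real.sin (π * y)) (Real.cos (π * y)) (Real.cos (2 * π * u))‖ ∧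
    Den (1 + a) (Real.sin (π * y)) (Real.cos (π * y)) (Real.cos (2 * π * u)) ≠ 0 := by
  have hc : 0 ≤ Real.cos (π * y) := by
    apply Real.cos_nonneg_of_mem_Icc
    constructor <;> nlinarith [hy.1, hy.2, Real.pi_pos]
  have h := den_lower (b := 1 + a) (by linarith) (Real.abs_sin_le_one (π * y)) hc
    (Real.cos_le_one _) (Real.neg_one_le_cos (2 * π * u)) (Real.cos_le_one _)
  refine ⟨h, ?_⟩
  intro h0
  rw [h0, norm_zero] at h
  have := abs_pos.mpr hs
  linarith [Real.cos_le_one (2 * π * u)]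

lemma Theta_cont (a y : ℝ) (ha : 0 ≤ a) (hy : y ∈ Set.Icc (-(1:ℝ)/2) (1/2))
    (hs : Real.sin (π * y) ≠ 0) : Continuous (fun x => Theta a (y - x) x) := by
  simp only [Theta_eq]
  apply Continuous.div
  · fun_prop
  · unfold Den; fun_prop
  · intro x; exact (Den_ne a y ha hy hs (x - y / 2)).2

lemma Theta_int (a y : ℝ) (ha : 0 ≤ a) (hy : y ∈ Set.Icc (-(1:ℝ)/2) (1/2))
    (hs : Real.sin (π * y) ≠ 0) :
    ∫ x in (-(1:ℝ)/2)..(1/2), ‖Theta a (y - x) x‖ ≤ 16 * √|Real.sin (π * y)| := by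
  have hpos := abs_pos.mpr hs
  have hr : 0 < √|Real.sin (π * y)| := Real.sqrt_pos.mpr hpos
  obtain ⟨hi, hb⟩ := int_bound hr
  have hcont := (Theta_cont a y ha hy hs).norm
  simp only [Theta_eq] at hcont ⊢
  set f : ℝ → ℝ := fun u => ‖Complex.I * ((Real.sin (π * y) * Real.cos (2 * π * u) : ℝ) : ℂ) /
      Den (1 + a) (Real.sin (π * y)) (Real.cos (π * y)) (Real.cos (2 * π * u))‖ with hf
  have hper : Function.Periodic f 1 := by
    intro x; simp only [hf, cos_per]
  have hcf : Continuous f := by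
    have : f = (fun x => f (x - y / 2)) ∘ (fun u => u + y / 2) := by
      ext u; simp
    rw [this]; exact hcont.comp (by fun_prop)
  have := shift_int f hper y
  simp only [hf] at this
  rw [this]
  calc ∫ x in (-(1:ℝ)/2)..(1/2), f x
      ≤ ∫ u in (-(1:ℝ)/2)..(1/2), 8 * (√|Real.sin (π * y)| ^ 2 /
          (√|Real.sin (π * y)| ^ 2 + 4 * u ^ 2)) := by
        apply intervalIntegral.integral_mono_on (by norm_num) (hcf.intervalIntegrable _ _)
          (hi.const_mul 8)
        intro u hu
        rw [Real.sq_sqrt hpos.le]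
        have h1 := (Den_ne a y ha hy hs u).1
        have h2 := sq_le_one_sub_cos (u := u) (by rw [abs_le]; constructor <;> linarith [hu.1, hu.2])
        have h3 := norm_pos_iff.mpr (Den_ne a y ha hy hs u).2
        simp only [hf]
        rw [norm_div, norm_mul, Complex.norm_I, one_mul, Complex.norm_real, Real.norm_eq_abs,
          abs_mul, ← mul_div_assoc, div_le_div_iff₀ h3 (by positivity)]
        have h4 := Real.abs_cos_le_one (2 * π * u)
        calc _ ≤ |Real.sin (π * y)| * 1 * (8 *
      ‖Den (1 + a) (Real.sin (π * y)) (Real.cos (π * y)) (Real.cos (2 * π * u))‖) := by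
                gcongr; linarith
          _ = _ := by ring
    _ ≤ _ := by
        rw [intervalIntegral.integral_const_mul]; linarith

lemma mul_Theta_int (a y : ℝ) (ha : 0 ≤ a) (hy : y ∈ Set.Icc (-(1:ℝ)/2) (1/2))
    (hs : Real.sin (π * y) ≠ 0) (f g : ℝ → ℂ) (K : ℝ)
    (hfg : ∀ x, f x = g x * Theta a (y - x) x) (hK : ∀ x, ‖g x‖ ≤ K) :
    ‖∫ x in (-(1:ℝ)/2)..(1/2), f x‖ ≤ K * (16 * √|Real.sin (π * y)|) := by
  have hK0 : 0 ≤ K := (norm_nonneg _).trans (hK 0)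
  have hc : Continuous (fun x => K * ‖Theta a (y - x) x‖) :=
    (Theta_cont a y ha hy hs).norm.const_mul K
  refine (intervalIntegral.norm_integral_le_of_norm_le (by norm_num) (.of_forall ?_)
    (hc.intervalIntegrable _ _)).trans ?_
  · intro x _
    rw [hfg, norm_mul]
    gcongr
    exact hK x
  · rw [intervalIntegral.integral_const_mul]
    gcongr
    exact Theta_int a y ha hy hs

lemma odd_Theta (a y : ℝ) :
    ∫ x in (-(1:ℝ)/2)..(1/2), ((Real.sin (2 * π * (x - y / 2)) : ℝ) : ℂ) * Theta a (y - x) x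
      = 0 := by
  simp only [Theta_eq]
  rw [shift_int (fun u => ((Real.sin (2 * π * u) : ℝ) : ℂ) *
    (Complex.I * ((Real.sin (π * y) * Real.cos (2 * π * u) : ℝ) : ℂ) /
      Den (1 + a) (Real.sin (π * y)) (Real.cos (π * y)) (Real.cos (2 * π * u))))
    (fun x => by simp only [cos_per, sin_per]) y]
  apply odd_int
  intro x
  have : 2 * π * (-x) = -(2 * π * x) := by ring
  rw [this, Real.cos_neg, Real.sin_neg]
  push_cast; ring

lemma norm_one_sub_exp (t : ℝ) : ‖1 - Complex.exp (Complex.I * t)‖ = 2 * |Real.sin (t / 2)| := by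
  rw [norm_sub_rev, Complex.norm_exp_I_mul_ofReal_sub_one, norm_mul]; simp

lemma half_sin (y : ℝ) (hy : y ∈ Set.Icc (-(1:ℝ)/2) (1/2)) :
    |Real.sin (π * y / 2)| ≤ |Real.sin (π * y)| := by
  have h : Real.sin (π * y) = 2 * Real.sin (π * y / 2) * Real.cos (π * y / 2) := by
    rw [← Real.sin_two_mul]; ring_nf
  have hc : 1 / 2 ≤ Real.cos (π * y / 2) := by
    rw [← Real.cos_pi_div_three, ← Real.cos_abs (π * y / 2)]
    apply Real.cos_le_cos_of_nonneg_of_le_pi (abs_nonneg _) (by linarith [Real.pi_pos])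
    rw [abs_le]
    constructor <;> nlinarith [hy.1, hy.2, Real.pi_pos]
  rw [h, abs_mul, abs_mul, abs_two, abs_of_nonneg (by linarith : 0 ≤ Real.cos (π * y / 2))]
  nlinarith [abs_nonneg (Real.sin (π * y / 2))]

lemma L_point (a y x : ℝ) (ha : 0 ≤ a) (hy : y ∈ Set.Icc (-(1:ℝ)/2) (1/2))
    (hs : Real.sin (π * y) ≠ 0) :
    (1 - Complex.exp (-(2 * (π : ℂ) * Complex.I * (x : ℂ)))) * Theta a (y - x) x =
    ((1 - Complex.exp (Complex.I * ((-(π * y) : ℝ) : ℂ))) +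
      Complex.exp (Complex.I * ((-(π * y) : ℝ) : ℂ)) * (Real.cos (2 * π * (x - y / 2)) : ℝ) *
        (-((1 - Real.cos (π * y) : ℝ) : ℂ) +
          Complex.I * ((Real.sin (π * y) / (1 + a) : ℝ) : ℂ))) * Theta a (y - x) x
    + (Complex.exp (Complex.I * ((-(π * y) : ℝ) : ℂ)) * Complex.I *
        ((Real.sin (π * y) / (1 + a) : ℝ) : ℂ)) * (Real.cos (2 * π * (x - y / 2)) : ℝ)
    + (Complex.exp (Complex.I * ((-(π * y) : ℝ) : ℂ)) * Complex.I) *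
      ((Real.sin (2 * π * (x - y / 2)) : ℝ) * Theta a (y - x) x) := by
  have hE : Complex.exp (-(2 * (π : ℂ) * Complex.I * (x : ℂ))) =
      Complex.exp (Complex.I * ((-(π * y) : ℝ) : ℂ)) *
      ((Real.cos (2 * π * (x - y / 2)) : ℝ) - Complex.I * (Real.sin (2 * π * (x - y / 2)) : ℝ)) := by
    have : (((Real.cos (2 * π * (x - y / 2)) : ℝ) : ℂ)
        - Complex.I * (Real.sin (2 * π * (x - y / 2)) : ℝ)) =
        Complex.exp (((-(2 * π * (x - y / 2)) : ℝ) : ℂ) * Complex.I) := by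
      rw [Complex.exp_mul_I, ← Complex.ofReal_cos, ← Complex.ofReal_sin, Real.cos_neg, Real.sin_neg]
      push_cast; ring
    rw [this, ← Complex.exp_add]
    congr 1; push_cast; ring
  have hD := (Den_ne a y ha hy hs (x - y / 2)).2
  have hT := Theta_eq a y x
  rw [eq_div_iff hD] at hT
  have hb : ((1 + a : ℝ) : ℂ) ≠ 0 := by
    rw [Ne, Complex.ofReal_eq_zero]; linarith
  rw [hE]
  generalize Complex.exp (Complex.I * ((-(π * y) : ℝ) : ℂ)) = E
  generalize Theta a (y - x) x = T at *
  unfold Den at hT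
  generalize Real.sin (2 * π * (x - y / 2)) = w at *
  generalize Real.cos (2 * π * (x - y / 2)) = v at *
  generalize Real.sin (π * y) = s at *
  generalize Real.cos (π * y) = c at *
  rw [Complex.ofReal_div]
  generalize 1 + a = b at *
  push_cast at *
  field_simp
  linear_combination E * hT

lemma L_bound (a y : ℝ) (ha : 0 ≤ a) (hy : y ∈ Set.Icc (-(1:ℝ)/2) (1/2))
    (hs : Real.sin (π * y) ≠ 0) :
    ‖∫ x in (-(1:ℝ)/2)..(1/2),
                (1 - Complex.exp (-(2 * (π : ℂ) * Complex.I * (x : ℂ))))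
                  * Theta a (y - x) x‖ ≤ (4 * |Real.sin (π * y)|) * (16 * √|Real.sin (π * y)|) := by
  have hT := Theta_cont a y ha hy hs
  simp only [L_point a y _ ha hy hs]
  rw [intervalIntegral.integral_add, intervalIntegral.integral_add,
    intervalIntegral.integral_const_mul, intervalIntegral.integral_const_mul, cos_int, odd_Theta,
    mul_zero, mul_zero, add_zero, add_zero]
  · refine mul_Theta_int a y ha hy hs _ _ _ (fun x => rfl) ?_
    intro x
    have hE : ‖Complex.exp (Complex.I * ((-(π * y) : ℝ) : ℂ))‖ = 1 :=
      Complex.norm_exp_I_mul_ofReal _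
    have h1 := norm_one_sub_exp (-(π * y))
    rw [neg_div, Real.sin_neg, abs_neg] at h1
    have h2 := half_sin y hy
    have hc : 0 ≤ Real.cos (π * y) := by
      apply Real.cos_nonneg_of_mem_Icc
      constructor <;> nlinarith [hy.1, hy.2, Real.pi_pos]
    have h3 : |1 - Real.cos (π * y)| ≤ |Real.sin (π * y)| := by
      rw [abs_of_nonneg (by linarith [Real.cos_le_one (π * y)])]
      have e1 := Real.sin_sq_add_cos_sq (π * y)
      have e2 := Real.abs_sin_le_one (π * y)
      have e3 := sq_abs (Real.sin (π * y))
      nlinarith [Real.cos_le_one (π * y), abs_nonneg (Real.sin (π * y))]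
    have h4 : |Real.sin (π * y) / (1 + a)| ≤ |Real.sin (π * y)| := by
      rw [abs_div, abs_of_nonneg (by linarith : 0 ≤ 1 + a)]
      exact div_le_self (abs_nonneg _) (by linarith)
    have h5 := Real.abs_cos_le_one (2 * π * (x - y / 2))
    refine (norm_add_le _ _).trans ?_
    rw [h1, norm_mul, norm_mul, hE, one_mul, Complex.norm_real, Real.norm_eq_abs]
    have h6 : ‖-((1 - Real.cos (π * y) : ℝ) : ℂ) +
          Complex.I * ((Real.sin (π * y) / (1 + a) : ℝ) : ℂ)‖ ≤ 2 * |Real.sin (π * y)| := by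
      refine (norm_add_le _ _).trans ?_
      rw [norm_neg, norm_mul, Complex.norm_I, one_mul, Complex.norm_real, Complex.norm_real,
        Real.norm_eq_abs, Real.norm_eq_abs]
      linarith
    have h7 := mul_le_mul h5 h6 (norm_nonneg _) zero_le_one
    linarith
  · apply Continuous.intervalIntegrable; fun_prop
  · apply Continuous.intervalIntegrable; fun_prop
  · apply Continuous.intervalIntegrable; fun_prop
  · apply Continuous.intervalIntegrable; fun_prop

/-- Uniform bounds on the residue integrals `I, J, K, L`:
`|I(y)| ≤ C|sin(πy)|^{1/2}`, `|J(y)|, |K(y)|, |L(y)| ≤ C|sin(πy)|^{3/2}`,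
uniformly in `y` and in `κγ ≥ 0` small. -/
theorem stmt_14 :
    ∃ C : ℝ, 0 < C ∧ ∃ ε : ℝ, 0 < ε ∧
      ∀ κ γ : ℝ, 0 ≤ κ → 0 ≤ γ → κ * γ ≤ ε →
        ∀ y ∈ Set.Icc (-(1:ℝ)/2) (1/2),
          ‖∫ x in (-(1:ℝ)/2)..(1/2), Theta (κ * γ) (y - x) x‖
              ≤ C * |Real.sin (π * y)| ^ ((1:ℝ)/2)
          ∧ ‖∫ x in (-(1:ℝ)/2)..(1/2), Theta (κ * γ) (y - x) x
                * Complex.exp (-(2 * (π : ℂ) * Complex.I * (x : ℂ)))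
                * (1 - Complex.exp (2 * (π : ℂ) * Complex.I * (y : ℂ)))‖
              ≤ C * |Real.sin (π * y)| ^ ((3:ℝ)/2)
          ∧ ‖-(∫ x in (-(1:ℝ)/2)..(1/2),
                Complex.I * ((Om (y - x) x : ℝ) : ℂ) * Theta (κ * γ) (y - x) x)‖
              ≤ C * |Real.sin (π * y)| ^ ((3:ℝ)/2)
          ∧ ‖∫ x in (-(1:ℝ)/2)..(1/2),
                (1 - Complex.exp (-(2 * (π : ℂ) * Complex.I * (x : ℂ))))
                  * Theta (κ * γ) (y - x) x‖
              ≤ C * |Real.sin (π * y)| ^ ((3:ℝ)/2) := by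
  refine ⟨64, by norm_num, 1, one_pos, ?_⟩
  intro κ γ hκ hγ _ y hy
  have ha : 0 ≤ κ * γ := mul_nonneg hκ hγ
  generalize κ * γ = a at *
  by_cases hs : Real.sin (π * y) = 0
  · have h0 : ∀ x, Theta a (y - x) x = 0 := by
      intro x; rw [Theta_eq, hs]; simp
    simp only [h0, hs]
    have e1 : (0:ℝ) ^ ((1:ℝ)/2) = 0 := Real.zero_rpow (by norm_num)
    have e2 : (0:ℝ) ^ ((3:ℝ)/2) = 0 := Real.zero_rpow (by norm_num)
    simp [e1, e2]
  have hpos := abs_pos.mpr hs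
  have r1 : |Real.sin (π * y)| ^ ((1:ℝ)/2) = √|Real.sin (π * y)| := (Real.sqrt_eq_rpow _).symm
  have r3 : |Real.sin (π * y)| ^ ((3:ℝ)/2) = |Real.sin (π * y)| * √|Real.sin (π * y)| := by
    rw [show (3:ℝ)/2 = 1 + 1/2 by norm_num, Real.rpow_add hpos, Real.rpow_one, r1]
  rw [r1, r3]
  have hr := Real.sqrt_nonneg |Real.sin (π * y)|
  have hrr := mul_nonneg hpos.le hr
  refine ⟨?_, ?_, ?_, ?_⟩
  · refine (mul_Theta_int a y ha hy hs _ (fun _ => 1) 1 (fun x => (one_mul _).symm) ?_).trans ?_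
    · intro x; simp
    · linarith
  · refine (mul_Theta_int a y ha hy hs _ (fun x =>
      Complex.exp (-(2 * (π : ℂ) * Complex.I * (x : ℂ)))
      * (1 - Complex.exp (2 * (π : ℂ) * Complex.I * (y : ℂ)))) (2 * |Real.sin (π * y)|)
      (fun x => by ring) ?_).trans ?_
    · intro x
      have e1 : -(2 * (π : ℂ) * Complex.I * (x : ℂ)) = Complex.I * ((-(2 * π * x) : ℝ) : ℂ) := by
        push_cast; ring
      have e2 : (2 * (π : ℂ) * Complex.I * (y : ℂ)) = Complex.I * ((2 * π * y : ℝ) : ℂ) := by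
        push_cast; ring
      rw [norm_mul, e1, e2, Complex.norm_exp_I_mul_ofReal, norm_one_sub_exp, one_mul]
      rw [show 2 * π * y / 2 = π * y by ring]
    · linarith
  · rw [norm_neg]
    refine (mul_Theta_int a y ha hy hs _ (fun x => Complex.I * ((Om (y - x) x : ℝ) : ℂ))
      (4 * |Real.sin (π * y)|) (fun x => rfl) ?_).trans ?_
    · intro x
      rw [norm_mul, Complex.norm_I, one_mul, Complex.norm_real, Real.norm_eq_abs, Om_eq, abs_mul,
        abs_mul, abs_of_pos (by norm_num : (0:ℝ) < 4)]
      have := Real.abs_cos_le_one (2 * π * (x - y / 2))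
      nlinarith
    · linarith
  · refine (L_bound a y ha hy hs).trans ?_
    linarith
end

section
/- Fix a sequence γ_n with γ_n → 0 and κ_n → 3. For y ∈ [-1/2,1/2] and ξ ∈ [-n/2, n/2], define G_n(y) = ((1+γ_nκ_n)²/4)·K(y), where K is the residue integral K(y) = -∫_{-1/2}^{1/2} iΩ(y-x,x)·Θ(y-x,x) dx with κγ = κ_nγ_n, and define G₀(ξ) = (1/2)|πξ|^{3/2}(1+i·sgn(ξ)). Then there is a constant C > 0 such that for all ξ ∈ [-n/2, n/2], |n^{3/2} G_n(ξ/n) - G₀(ξ)| ≤ C(γ_n|ξ|^{3/2} + |ξ|²/√n). -/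
open Real MeasureTheory Filter

/-- `K(y) = -∫ iΩ(y-x,x) Θ(y-x,x) dx`. -/
noncomputable def Kfn (a : ℝ) (y : ℝ) : ℂ :=
  -(∫ x in (-(1:ℝ)/2)..(1/2), Complex.I * ((Om (y - x) x : ℝ) : ℂ) * Theta a (y - x) x)

/-- `Gₙ(y) = ((1+γₙκₙ)²/4) K(y)` with anharmonicity `a = κₙγₙ`. -/
noncomputable def Gn (a : ℝ) (y : ℝ) : ℂ := (((1 + a) ^ 2 / 4 : ℝ) : ℂ) * Kfn a y

/-- `G₀(ξ) = (1/2)|πξ|^{3/2}(1 + i sgn ξ)`. -/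
noncomputable def G0 (v : ℝ) : ℂ :=
  (1/2 : ℂ) * ((|π * v| ^ ((3:ℝ)/2) : ℝ) : ℂ) * (1 + Complex.I * ((Real.sign v : ℝ) : ℂ))

lemma aux_circ (r : ℂ) (hr : ‖r‖ < 1) :
    ∫ θ in (0:ℝ)..(2 * π), (1 - r * Complex.exp (θ * Complex.I))⁻¹ = 2 * π := by
  have hne : ∀ z ∈ Metric.closedBall (0:ℂ) 1, 1 - r * z ≠ 0 := by
    intro z hz h
    have h1 : r * z = 1 := by linear_combination -h
    have h2 : ‖r‖ * ‖z‖ = 1 := by rw [← norm_mul, h1, norm_one]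
    have h3 : ‖z‖ ≤ 1 := by simpa using hz
    nlinarith [norm_nonneg r, norm_nonneg z]
  have hd : DiffContOnCl ℂ (fun z : ℂ => (1 - r * z)⁻¹) (Metric.ball 0 |(1:ℝ)|) := by
    apply DifferentiableOn.diffContOnCl
    rw [abs_one, closure_ball _ one_ne_zero]
    intro z hz
    exact DifferentiableAt.differentiableWithinAt
      (DifferentiableAt.inv (by fun_prop) (hne z hz))
  have h := hd.circleAverage
  rw [Real.circleAverage_def] at h
  simp only [circleMap, zero_add, Complex.ofReal_one, one_mul, mul_zero, sub_zero, inv_one] at h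
  have hpi : (2 * π : ℝ) ≠ 0 := by positivity
  rw [inv_smul_eq_iff₀ hpi] at h
  rw [h]; simp

lemma aux_circ' (r : ℂ) (hr : ‖r‖ < 1) :
    ∫ θ in (0:ℝ)..(2 * π), (1 - r * Complex.exp (-(θ * Complex.I)))⁻¹ = 2 * π := by
  rw [← aux_circ r hr]
  have := intervalIntegral.integral_comp_sub_left (a := 0) (b := 2 * π)
    (fun θ : ℝ => (1 - r * Complex.exp (θ * Complex.I))⁻¹) (2 * π)
  simp only [sub_self, sub_zero] at this
  rw [← this]
  apply intervalIntegral.integral_congr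
  intro θ _
  simp only
  congr 3
  push_cast
  rw [sub_mul, Complex.exp_sub, Complex.exp_two_pi_mul_I, Complex.exp_neg, one_div]

lemma aux_ne (r : ℂ) (hr : ‖r‖ < 1) (E : ℂ) (hE : ‖E‖ = 1) : 1 - r * E ≠ 0 := by
  intro h
  have h1 : r * E = 1 := by linear_combination -h
  have h2 : ‖r‖ * ‖E‖ = 1 := by rw [← norm_mul, h1, norm_one]
  rw [hE] at h2
  linarith

lemma aux_alg (b q w r E F : ℂ) (hw2 : w ^ 2 = b ^ 2 - q ^ 2) (hq : q ≠ 0) (hw : w ≠ 0)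
    (hbw : b + w ≠ 0) (hr : r = q / (b + w)) (hEF : E * F = 1)
    (h1 : 1 - r * E ≠ 0) (h2 : 1 - r * F ≠ 0) :
    ((E + F) / 2) ^ 2 / (b - q * ((E + F) / 2)) =
      -((E + F) / 2) / q - b / q ^ 2 + b ^ 2 / (q ^ 2 * w) *
        ((1 - r * E)⁻¹ + (1 - r * F)⁻¹ - 1) := by
  have hrb : r * (b + w) = q := by rw [hr]; field_simp
  have key : (1 - r * E) * (1 - r * F) * (b + w) = 2 * (b - q * ((E + F) / 2)) := by
    have h3 : r ^ 2 * (b + w) = b - w := by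
      apply mul_right_cancel₀ hbw
      linear_combination (r * (b + w) + q) * hrb + hw2
    linear_combination (r ^ 2 * (b + w)) * hEF + h3 - (E + F) * hrb
  have hden : b - q * ((E + F) / 2) ≠ 0 := by
    intro h
    rw [h, mul_zero] at key
    exact mul_ne_zero (mul_ne_zero h1 h2) hbw key
  have h4 : (1 - r * E)⁻¹ + (1 - r * F)⁻¹ - 1 = w / (b - q * ((E + F) / 2)) := by
    have h3 : r ^ 2 * (b + w) = b - w := by
      apply mul_right_cancel₀ hbw
      linear_combination (r * (b + w) + q) * hrb + hw2
    have h5 : (1 - r * E)⁻¹ + (1 - r * F)⁻¹ - 1 =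
        (1 - r ^ 2) / ((1 - r * E) * (1 - r * F)) := by
      field_simp
      linear_combination (-r ^ 2) * hEF
    rw [h5, div_eq_div_iff (mul_ne_zero h1 h2) hden]
    apply mul_right_cancel₀ hbw
    linear_combination (-w) * key - (b - q * ((E + F) / 2)) * h3
  rw [h4]
  clear h4 key
  generalize (E + F) / 2 = k at *
  obtain ⟨m, hm⟩ : ∃ m, m = b - q * k := ⟨_, rfl⟩
  have hk : k = (b - m) / q := by rw [hm]; field_simp; ring
  rw [← hm] at hden ⊢
  rw [hk]
  field_simp
  ring

lemma aux_mean (b : ℝ) (q w : ℂ) (hb : 0 < b) (hw2 : w ^ 2 = (b:ℂ) ^ 2 - q ^ 2) (hq : q ≠ 0)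
    (hw : 0 < w.re) (hqb : ‖q‖ ≤ b) :
    ∫ θ in (0:ℝ)..(2 * π), ((Real.cos θ : ℝ) : ℂ) ^ 2 / (b - q * ((Real.cos θ : ℝ) : ℂ)) =
      2 * π * ((b:ℂ) ^ 2 / (q ^ 2 * w) - b / q ^ 2) := by
  have hw0 : w ≠ 0 := by rintro rfl; simp at hw
  have hlt : b < ‖(b:ℂ) + w‖ := by
    calc b < ((b:ℂ) + w).re := by simpa using hw
      _ ≤ _ := Complex.re_le_norm _
  have hbw : (b:ℂ) + w ≠ 0 := by
    rw [← norm_pos_iff]; linarith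
  set r : ℂ := q / (b + w) with hr
  have hr1 : ‖r‖ < 1 := by
    rw [hr, norm_div, div_lt_one (by linarith)]; linarith
  have hE : ∀ θ : ℝ, ‖Complex.exp (θ * Complex.I)‖ = 1 := Complex.norm_exp_ofReal_mul_I
  have hF : ∀ θ : ℝ, ‖Complex.exp (-(θ * Complex.I))‖ = 1 := by
    intro θ; rw [Complex.exp_neg, norm_inv, hE, inv_one]
  have hpt : ∀ θ : ℝ, ((Real.cos θ : ℝ) : ℂ) ^ 2 / (b - q * ((Real.cos θ : ℝ) : ℂ)) =
      (-((Real.cos θ : ℝ) : ℂ) / q - b / q ^ 2) + (b:ℂ) ^ 2 / (q ^ 2 * w) *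
        ((1 - r * Complex.exp (θ * Complex.I))⁻¹ + (1 - r * Complex.exp (-(θ * Complex.I)))⁻¹ - 1) := by
    intro θ
    have := aux_alg b q w r (Complex.exp (θ * Complex.I)) (Complex.exp (-(θ * Complex.I))) hw2 hq
      hw0 hbw hr (by rw [← Complex.exp_add]; simp) (aux_ne r hr1 _ (hE θ)) (aux_ne r hr1 _ (hF θ))
    have hc : ((Real.cos θ : ℝ) : ℂ) =
        (Complex.exp (θ * Complex.I) + Complex.exp (-(θ * Complex.I))) / 2 := by
      rw [Complex.ofReal_cos, Complex.cos, neg_mul]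
    rw [hc]; exact this
  have c1 : Continuous fun θ : ℝ => (1 - r * Complex.exp (θ * Complex.I))⁻¹ :=
    Continuous.inv₀ (by fun_prop) (fun θ => aux_ne r hr1 _ (hE θ))
  have c2 : Continuous fun θ : ℝ => (1 - r * Complex.exp (-(θ * Complex.I)))⁻¹ :=
    Continuous.inv₀ (by fun_prop) (fun θ => aux_ne r hr1 _ (hF θ))
  have c3 : Continuous fun θ : ℝ => -((Real.cos θ : ℝ) : ℂ) / q := by fun_prop
  rw [intervalIntegral.integral_congr (fun θ _ => hpt θ)]
  rw [intervalIntegral.integral_add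
    (Continuous.intervalIntegrable (by fun_prop) _ _)
    (Continuous.intervalIntegrable (by fun_prop) _ _),
    intervalIntegral.integral_sub (c3.intervalIntegrable _ _) (by simp),
    intervalIntegral.integral_const_mul,
    intervalIntegral.integral_sub (Continuous.intervalIntegrable (by fun_prop) _ _) (by simp),
    intervalIntegral.integral_add (c1.intervalIntegrable _ _) (c2.intervalIntegrable _ _),
    aux_circ r hr1, aux_circ' r hr1, intervalIntegral.integral_div,
    intervalIntegral.integral_neg, intervalIntegral.integral_ofReal, integral_cos]
  simp
  ring

lemma aux_sqrt (D : ℂ) (hD : 0 < D.re) : ∃ w : ℂ, w ^ 2 = D ∧ 0 < w.re := by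
  obtain ⟨z, hz⟩ := IsAlgClosed.exists_pow_nat_eq D zero_lt_two
  have h : z.re ≠ 0 := by
    intro h
    rw [← hz] at hD
    simp [pow_two, h] at hD
    nlinarith [mul_self_nonneg z.im]
  rcases lt_or_gt_of_ne h with h | h
  · exact ⟨-z, by rw [neg_sq, hz], by simpa using h⟩
  · exact ⟨z, hz, h⟩

lemma aux_K (a y : ℝ) (ha : 0 ≤ a) (w : ℂ) (hs : Real.sin (π * y) ≠ 0)
    (q : ℂ) (hq : q = ((1 + a : ℝ) : ℂ) * (Real.cos (π * y) : ℝ) + Complex.I * (Real.sin (π * y) : ℝ))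
    (hw2 : w ^ 2 = ((1 + a : ℝ) : ℂ) ^ 2 - q ^ 2) (hw : 0 < w.re) :
    Kfn a y = 4 * ((Real.sin (π * y) : ℝ) : ℂ) ^ 2 *
      (((1 + a : ℝ) : ℂ) ^ 2 / (q ^ 2 * w) - ((1 + a : ℝ) : ℂ) / q ^ 2) := by
  have hb : 0 < 1 + a := by linarith
  have hre : q.re = (1 + a) * Real.cos (π * y) := by simp [hq, -Complex.ofReal_cos, -Complex.ofReal_sin]
  have him : q.im = Real.sin (π * y) := by simp [hq, -Complex.ofReal_cos, -Complex.ofReal_sin]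
  have hq0 : q ≠ 0 := by rintro rfl; simp at him; exact hs him.symm
  have hqb : ‖q‖ ≤ 1 + a := by
    rw [Complex.norm_def, Complex.normSq_apply, hre, him]
    apply Real.sqrt_le_iff.2 ⟨hb.le, _⟩
    nlinarith [Real.sin_sq_add_cos_sq (π * y), sq_nonneg (Real.sin (π * y)),
      mul_nonneg ha (sq_nonneg (Real.sin (π * y))), mul_nonneg (mul_nonneg ha ha) (sq_nonneg (Real.sin (π * y)))]
  have hm := aux_mean (1 + a) q w hb hw2 hq0 hw hqb
  set g : ℝ → ℂ := fun θ => ((Real.cos θ : ℝ) : ℂ) ^ 2 / (((1 + a : ℝ) : ℂ) - q * ((Real.cos θ : ℝ) : ℂ)) with hg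
  have hper : Function.Periodic g (2 * π) := by
    intro θ; simp only [hg, Real.cos_add_two_pi]
  have hpt : ∀ x : ℝ, Complex.I * ((Om (y - x) x : ℝ) : ℂ) * Theta a (y - x) x =
      -(4 * ((Real.sin (π * y) : ℝ) : ℂ) ^ 2) * g (π * y - 2 * π * x) := by
    intro x
    have h1 : Om (y - x) x = 4 * Real.sin (π * y) * Real.cos (π * y - 2 * π * x) := by
      have e1 : 2 * π * (y - x) = π * y + (π * y - 2 * π * x) := by ring
      have e2 : 2 * π * x = π * y - (π * y - 2 * π * x) := by ring
      have s1 := Real.sin_add (π * y) (π * y - 2 * π * x)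
      have s2 := Real.sin_sub (π * y) (π * y - 2 * π * x)
      rw [← e1] at s1
      rw [← e2] at s2
      rw [Om, s1, s2]; ring
    have h2 : Lam (y - x) x = 4 - 4 * Real.cos (π * y) * Real.cos (π * y - 2 * π * x) := by
      have f : ∀ z : ℝ, Real.sin z ^ 2 = 1 / 2 - Real.cos (2 * z) / 2 := Real.sin_sq_eq_half_sub
      have e1 : 2 * (π * (y - x)) = π * y + (π * y - 2 * π * x) := by ring
      have e2 : 2 * (π * x) = π * y - (π * y - 2 * π * x) := by ring
      have s1 := Real.cos_add (π * y) (π * y - 2 * π * x)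
      have s2 := Real.cos_sub (π * y) (π * y - 2 * π * x)
      rw [← e1] at s1
      rw [← e2] at s2
      rw [Lam, f, f, s1, s2]; ring
    rw [Theta, h1, h2, hg]
    simp only
    generalize Real.cos (π * y - 2 * π * x) = k
    have h3 : ((1 + a : ℝ) : ℂ) * ((4 - 4 * Real.cos (π * y) * k : ℝ) : ℂ) -
        Complex.I * ((4 * Real.sin (π * y) * k : ℝ) : ℂ) = 4 * (((1 + a : ℝ) : ℂ) - q * (k : ℂ)) := by
      rw [hq]; push_cast; ring
    rw [h3]
    push_cast
    rw [mul_div_assoc', mul_div_assoc', show Complex.I * (4 * Complex.sin (π * y) * k) * (Complex.I * (4 * Complex.sin (π * y) * k)) =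
      4 * (-(4 * Complex.sin (π * y) ^ 2) * k ^ 2) by linear_combination (16 * Complex.sin (π * y) ^ 2 * k ^ 2) * Complex.I_sq]
    rw [mul_div_mul_left _ _ (by norm_num)]
  rw [Kfn, intervalIntegral.integral_congr (fun x _ => hpt x), intervalIntegral.integral_const_mul]
  rw [intervalIntegral.integral_comp_sub_mul g (by positivity : (2 * π) ≠ 0)]
  have e1 : π * y - 2 * π * (-1 / 2) = (π * y - 2 * π * (1 / 2)) + 2 * π := by ring
  rw [e1, hper.intervalIntegral_add_eq _ 0, zero_add, hm]
  simp only [Complex.real_smul]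
  push_cast
  have hpi : (π : ℂ) ≠ 0 := by exact_mod_cast Real.pi_ne_zero
  field_simp

set_option maxHeartbeats 2000000 in
lemma aux_core (a σ u c : ℝ) (ha : 0 ≤ a) (ha4 : a ≤ 4) (hσ : σ = 1 ∨ σ = -1) (hu : 0 < u)
    (hu1 : u ≤ 1) (huc : u ^ 4 + c ^ 2 = 1) (hc : 0 ≤ c) (q w : ℂ)
    (hq : q = ((1 + a : ℝ) : ℂ) * (c : ℂ) + Complex.I * ((σ * u ^ 2 : ℝ) : ℂ))
    (hw2 : w ^ 2 = ((1 + a : ℝ) : ℂ) ^ 2 - q ^ 2) (hw : 0 < w.re) :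
    ‖(((1 + a) ^ 2 / 4 : ℝ) : ℂ) * (4 * ((σ * u ^ 2 : ℝ) : ℂ) ^ 2 *
      (((1 + a : ℝ) : ℂ) ^ 2 / (q ^ 2 * w) - ((1 + a : ℝ) : ℂ) / q ^ 2)) -
      (1/2 : ℂ) * ((u ^ 3 : ℝ) : ℂ) * (1 + Complex.I * (σ : ℂ))‖ ≤ 152 * a * u ^ 3 + 189 * u ^ 4 := by
  have hσ2 : σ ^ 2 = 1 := by rcases hσ with h | h <;> rw [h] <;> norm_num
  obtain ⟨b, hb⟩ : ∃ b : ℝ, b = 1 + a := ⟨_, rfl⟩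
  rw [← hb] at hq hw2 ⊢
  have hb1 : 1 ≤ b := by linarith
  have hb5 : b ≤ 5 := by linarith
  have hw0 : w ≠ 0 := by rintro rfl; simp at hw
  have hu2 : 0 < u ^ 2 := by positivity
  have hu2' : u ^ 2 ≤ 1 := by nlinarith
  have hc1 : c ≤ 1 := by nlinarith [sq_nonneg (u ^ 2)]
  have hc2 : 1 - c ≤ u ^ 4 := by nlinarith
  have hqre : q.re = b * c := by rw [hq]; simp [← Complex.ofReal_pow]
  have hqim : q.im = σ * u ^ 2 := by rw [hq]; simp [← Complex.ofReal_pow]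
  -- norm of q
  have hq1 : 1 ≤ ‖q ^ 2‖ := by
    rw [norm_pow, ← Complex.normSq_eq_norm_sq, Complex.normSq_apply, hqre, hqim]
    have : σ * u ^ 2 * (σ * u ^ 2) = u ^ 4 := by linear_combination u ^ 4 * hσ2
    rw [this]
    nlinarith [mul_nonneg (sq_nonneg c) (by nlinarith : 0 ≤ b ^ 2 - 1)]
  have hq0 : q ≠ 0 := by rintro rfl; norm_num at hq1
  -- D
  have hDre : (w ^ 2).re = u ^ 4 * (b ^ 2 + 1) := by
    rw [hw2, Complex.sub_re, pow_two q, Complex.mul_re, hqre, hqim]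
    simp only [← Complex.ofReal_pow, Complex.ofReal_re]
    linear_combination u ^ 4 * hσ2 - b ^ 2 * huc
  have hDim : (w ^ 2).im = -2 * b * c * σ * u ^ 2 := by
    rw [hw2, Complex.sub_im, pow_two q, Complex.mul_im, hqre, hqim]
    simp only [← Complex.ofReal_pow, Complex.ofReal_im]
    ring
  have hDlow : u ^ 2 ≤ ‖w‖ ^ 2 := by
    rw [← norm_pow]
    apply (sq_le_sq₀ hu2.le (norm_nonneg _)).1
    rw [← Complex.normSq_eq_norm_sq, Complex.normSq_apply, hDre, hDim]
    have e : -2 * b * c * σ * u ^ 2 * (-2 * b * c * σ * u ^ 2) = u ^ 4 * (4 * b ^ 2 * c ^ 2) := by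
      linear_combination (4 * b ^ 2 * c ^ 2 * u ^ 4) * hσ2
    have e2 : u ^ 4 * (b ^ 2 + 1) * (u ^ 4 * (b ^ 2 + 1)) = u ^ 4 * (u ^ 4 * (b ^ 2 + 1) ^ 2) := by ring
    rw [e, e2, ← mul_add]
    have : 1 ≤ u ^ 4 * (b ^ 2 + 1) ^ 2 + 4 * b ^ 2 * c ^ 2 := by
      have h1 : 4 * b ^ 2 ≤ (b ^ 2 + 1) ^ 2 := by nlinarith [sq_nonneg (b ^ 2 - 1)]
      have h2 : u ^ 4 * (4 * b ^ 2) ≤ u ^ 4 * (b ^ 2 + 1) ^ 2 := by gcongr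
      nlinarith
    have h4 : 0 ≤ u ^ 4 := by positivity
    nlinarith
  have hwu : u ≤ ‖w‖ := (sq_le_sq₀ hu.le (norm_nonneg _)).1 hDlow
  have hDup : ‖w ^ 2‖ ≤ 36 * u ^ 2 := by
    refine (Complex.norm_le_abs_re_add_abs_im _).trans ?_
    have hσa : |σ| = 1 := by rcases hσ with h | h <;> rw [h] <;> norm_num
    rw [hDre, hDim]
    simp only [abs_mul, hσa, abs_of_nonneg (by positivity : 0 ≤ u ^ 4), abs_of_nonneg hc,
      abs_of_nonneg (by positivity : 0 ≤ u ^ 2), abs_of_nonneg (by positivity : 0 ≤ b ^ 2 + 1),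
      abs_of_nonneg (by linarith : 0 ≤ b)]
    norm_num
    have h1 : u ^ 4 * (b ^ 2 + 1) ≤ u ^ 2 * 26 := by
      apply mul_le_mul _ _ (by positivity) (by positivity)
      · nlinarith
      · nlinarith
    have h2 : 2 * b * c * u ^ 2 ≤ 10 * u ^ 2 := by
      gcongr
      nlinarith
    linarith
  -- w0
  obtain ⟨v, hv⟩ : ∃ v : ℂ, v = (u : ℂ) * (1 - Complex.I * (σ : ℂ)) := ⟨_, rfl⟩
  have hvre : v.re = u := by rw [hv]; simp
  have hσC : (σ : ℂ) ^ 2 = 1 := by exact_mod_cast hσ2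
  have hvv : v * (1 + Complex.I * (σ : ℂ)) = 2 * u := by
    rw [hv]; linear_combination (-(u:ℂ) * σ ^ 2) * Complex.I_sq + (u : ℂ) * hσC
  have hvu : u ≤ ‖v‖ := by rw [← hvre]; exact Complex.re_le_norm _
  have hv0 : v ≠ 0 := by rintro rfl; simp at hvre; linarith
  have hv2 : v ^ 2 = -2 * Complex.I * ((σ * u ^ 2 : ℝ) : ℂ) := by
    rw [hv]; push_cast
    linear_combination ((u:ℂ) ^ 2 * σ ^ 2) * Complex.I_sq - (u : ℂ) ^ 2 * hσC
  have hdiff2 : ‖v ^ 2 - w ^ 2‖ ≤ 28 * u ^ 4 + 2 * a * u ^ 2 := by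
    refine (Complex.norm_le_abs_re_add_abs_im _).trans ?_
    have r1 : (v ^ 2 - w ^ 2).re = -(u ^ 4 * (b ^ 2 + 1)) := by
      rw [Complex.sub_re, hDre, hv2]; simp [← Complex.ofReal_pow]
    have r2 : (v ^ 2 - w ^ 2).im = -2 * u ^ 2 * (1 - b * c) * σ := by
      rw [Complex.sub_im, hDim, hv2]; simp [← Complex.ofReal_pow]; ring
    have hσa : |σ| = 1 := by rcases hσ with h | h <;> rw [h] <;> norm_num
    rw [r1, r2, abs_neg, abs_mul _ σ, hσa, mul_one, abs_of_nonneg (by positivity : 0 ≤ u ^ 4 * (b ^ 2 + 1)),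
      abs_mul, abs_mul, abs_of_nonneg (by positivity : 0 ≤ u ^ 2)]
    norm_num
    have h1 : |1 - b * c| ≤ u ^ 4 + a := by
      rw [abs_le]; constructor
      · nlinarith [mul_le_mul_of_nonneg_left hc1 ha, pow_pos hu 4]
      · nlinarith [mul_nonneg ha hc]
    have h2 : 2 * u ^ 2 * |1 - b * c| ≤ 2 * u ^ 2 * (u ^ 4 + a) := by gcongr
    have h3 : u ^ 2 * u ^ 4 ≤ 1 * u ^ 4 := by gcongr
    have h4 : u ^ 4 * (b ^ 2 + 1) ≤ u ^ 4 * 26 := by gcongr; nlinarith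
    have h5 : 2 * u ^ 2 * (u ^ 4 + a) = 2 * (u ^ 2 * u ^ 4) + 2 * a * u ^ 2 := by ring
    linarith
  have hsum : u ≤ ‖v + w‖ := by
    refine le_trans ?_ (Complex.re_le_norm _)
    rw [Complex.add_re, hvre]; linarith
  have hdiff : ‖v - w‖ ≤ 28 * u ^ 3 + 2 * a * u := by
    have h1 : ‖v - w‖ * ‖v + w‖ = ‖v ^ 2 - w ^ 2‖ := by rw [← norm_mul]; congr 1; ring
    have h2 : ‖v - w‖ * u ≤ ‖v - w‖ * ‖v + w‖ := by gcongr
    have h3 : ‖v - w‖ * u ≤ (28 * u ^ 3 + 2 * a * u) * u := by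
      calc _ ≤ _ := h2
        _ = _ := h1
        _ ≤ _ := hdiff2
        _ = _ := by ring
    exact le_of_mul_le_mul_right h3 hu
  have hmain : (((b ^ 2 / 4 : ℝ)) : ℂ) * (4 * ((σ * u ^ 2 : ℝ) : ℂ) ^ 2 *
      ((b : ℂ) ^ 2 / (q ^ 2 * w) - (b : ℂ) / q ^ 2)) -
      (1/2 : ℂ) * ((u ^ 3 : ℝ) : ℂ) * (1 + Complex.I * (σ : ℂ)) =
      ((u ^ 4 : ℝ) : ℂ) * (((b:ℂ) ^ 4 - q ^ 2) / (q ^ 2 * w) + (v - w) / (w * v) - (b:ℂ) ^ 3 / q ^ 2) := by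
    have h1 : (1 + Complex.I * (σ : ℂ)) = 2 * u / v := by field_simp; linear_combination hvv
    have h2 : ((σ * u ^ 2 : ℝ) : ℂ) ^ 2 = (u:ℂ) ^ 4 := by
      push_cast; linear_combination (u:ℂ) ^ 4 * hσC
    rw [h1, h2]
    push_cast
    field_simp
    ring
  rw [hmain, norm_mul, Complex.norm_real, Real.norm_of_nonneg (by positivity)]
  have hA : ‖((b:ℂ) ^ 4 - q ^ 2) / (q ^ 2 * w)‖ ≤ (150 * a + 36 * u ^ 2) / u := by
    rw [norm_div, norm_mul]
    have h1 : ‖(b:ℂ) ^ 4 - q ^ 2‖ ≤ 150 * a + 36 * u ^ 2 := by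
      have e : (b:ℂ) ^ 4 - q ^ 2 = ((b ^ 4 - b ^ 2 : ℝ) : ℂ) + w ^ 2 := by rw [hw2]; push_cast; ring
      rw [e]
      refine (norm_add_le _ _).trans (add_le_add ?_ hDup)
      rw [Complex.norm_real, Real.norm_of_nonneg (by nlinarith [sq_nonneg b, mul_nonneg (sq_nonneg b) (by nlinarith : 0 ≤ b ^ 2 - 1)])]
      have e3 : b ^ 4 - b ^ 2 = (b ^ 2 * (b + 1)) * a := by rw [hb]; ring
      rw [e3]
      gcongr
      nlinarith [mul_nonneg (by linarith : 0 ≤ 5 - b) (by linarith : 0 ≤ b), mul_nonneg (by linarith : 0 ≤ 5 - b) (sq_nonneg b)]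
    apply div_le_div₀ (by positivity) h1 hu
    nlinarith
  have hB : ‖(v - w) / (w * v)‖ ≤ (28 * u ^ 3 + 2 * a * u) / (u * u) := by
    rw [norm_div, norm_mul]
    apply div_le_div₀ (by positivity) hdiff (by positivity)
    gcongr
  have hC : ‖(b:ℂ) ^ 3 / q ^ 2‖ ≤ 125 / 1 := by
    rw [norm_div]
    apply div_le_div₀ (by positivity) _ one_pos hq1
    rw [norm_pow, Complex.norm_real, Real.norm_of_nonneg (by linarith)]
    calc b ^ 3 ≤ 5 ^ 3 := by gcongr
      _ = 125 := by norm_num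
  calc u ^ 4 * ‖((b:ℂ) ^ 4 - q ^ 2) / (q ^ 2 * w) + (v - w) / (w * v) - (b:ℂ) ^ 3 / q ^ 2‖
      ≤ u ^ 4 * ((150 * a + 36 * u ^ 2) / u + (28 * u ^ 3 + 2 * a * u) / (u * u) + 125 / 1) := by
        gcongr
        exact (norm_sub_le _ _).trans (add_le_add ((norm_add_le _ _).trans (add_le_add hA hB)) hC)
    _ = 152 * a * u ^ 3 + 64 * u ^ 5 + 125 * u ^ 4 := by field_simp; ring
    _ ≤ _ := by nlinarith [mul_le_mul_of_nonneg_left hu1 (pow_pos hu 4).le]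

lemma aux_rpow (x : ℝ) (hx : 0 ≤ x) : x ^ ((3:ℝ)/2) = Real.sqrt x ^ 3 := by
  rw [Real.sqrt_eq_rpow, ← Real.rpow_natCast, ← Real.rpow_mul hx]; norm_num

lemma aux_y (a y : ℝ) (ha : 0 ≤ a) (ha4 : a ≤ 4) (hy : |y| ≤ 1 / 2) :
    ‖Gn a y - G0 y‖ ≤ 152 * a * |π * y| ^ ((3:ℝ)/2) + 193 * |π * y| ^ 2 := by
  by_cases hy0 : y = 0
  · subst hy0
    have hO : ∀ x : ℝ, Om (-x) x = 0 := by
      intro x; simp [Om]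
    simp [Gn, Kfn, G0, hO]
  have hypos : 0 < |y| := abs_pos.2 hy0
  obtain ⟨p, hp⟩ : ∃ p, p = |π * y| := ⟨_, rfl⟩
  have hp' : p = π * |y| := by rw [hp, abs_mul, abs_of_pos Real.pi_pos]
  have hp0 : 0 < p := by rw [hp']; positivity
  have hp2 : p ≤ π / 2 := by rw [hp']; nlinarith [Real.pi_pos]
  have hp2' : p ≤ 2 := by linarith [Real.pi_le_four]
  have hsp : 0 < Real.sin p := Real.sin_pos_of_pos_of_lt_pi hp0 (by linarith [Real.pi_pos])
  have hσ : Real.sign y = 1 ∨ Real.sign y = -1 := by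
    rcases lt_or_gt_of_ne hy0 with h | h
    · right; exact Real.sign_of_neg h
    · left; exact Real.sign_of_pos h
  obtain ⟨u, hu⟩ : ∃ u, u = Real.sqrt (Real.sin p) := ⟨_, rfl⟩
  have hu0 : 0 < u := by rw [hu]; exact Real.sqrt_pos.2 hsp
  have hu2 : u ^ 2 = Real.sin p := by rw [hu]; exact Real.sq_sqrt hsp.le
  have hu1 : u ≤ 1 := by rw [hu]; exact Real.sqrt_le_one.2 (Real.sin_le_one p)
  have hs : Real.sin (π * y) = Real.sign y * u ^ 2 := by
    rw [hu2, hp']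
    rcases lt_or_gt_of_ne hy0 with h | h
    · rw [Real.sign_of_neg h, abs_of_neg h, mul_neg, Real.sin_neg]; ring
    · rw [Real.sign_of_pos h, abs_of_pos h, one_mul]
  have hsne : Real.sin (π * y) ≠ 0 := by
    rw [hs]; rcases hσ with h | h <;> rw [h] <;> simp [hu0.ne']
  have hcp : Real.cos (π * y) = Real.cos p := by rw [hp, Real.cos_abs]
  have hc0 : 0 ≤ Real.cos (π * y) := by
    rw [hcp]; exact Real.cos_nonneg_of_neg_pi_div_two_le_of_le (by linarith) hp2
  have huc : u ^ 4 + Real.cos (π * y) ^ 2 = 1 := by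
    rw [hcp, ← Real.sin_sq_add_cos_sq p, ← hu2]; ring
  obtain ⟨q, hq⟩ : ∃ q : ℂ, q = ((1 + a : ℝ) : ℂ) * (Real.cos (π * y) : ℝ) +
    Complex.I * (Real.sin (π * y) : ℝ) := ⟨_, rfl⟩
  have hre : q.re = (1 + a) * Real.cos (π * y) := by simp [hq, -Complex.ofReal_cos, -Complex.ofReal_sin]
  have him : q.im = Real.sin (π * y) := by simp [hq, -Complex.ofReal_cos, -Complex.ofReal_sin]
  obtain ⟨w, hw2, hw⟩ := aux_sqrt (((1 + a : ℝ) : ℂ) ^ 2 - q ^ 2) (by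
    rw [Complex.sub_re, pow_two q, Complex.mul_re, hre, him, ← Complex.ofReal_pow, Complex.ofReal_re]
    have e : (1 + a) ^ 2 - ((1 + a) * Real.cos (π * y) * ((1 + a) * Real.cos (π * y)) -
        Real.sin (π * y) * Real.sin (π * y)) = Real.sin (π * y) ^ 2 * ((1 + a) ^ 2 + 1) := by
      linear_combination (-(1 + a) ^ 2) * Real.sin_sq_add_cos_sq (π * y)
    rw [e]; positivity)
  have hK := aux_K a y ha w hsne q hq hw2 hw
  rw [hs] at hq hK
  have hcore := aux_core a (Real.sign y) u (Real.cos (π * y)) ha ha4 hσ hu0 hu1 huc hc0 q w hq hw2 hw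
  rw [← hK, ← Gn] at hcore
  obtain ⟨m, hm⟩ : ∃ m, m = Real.sqrt p := ⟨_, rfl⟩
  have hm0 : 0 < m := by rw [hm]; exact Real.sqrt_pos.2 hp0
  have hm2 : m ^ 2 = p := by rw [hm]; exact Real.sq_sqrt hp0.le
  have hsinle : Real.sin p ≤ p := (Real.sin_lt hp0).le
  have hum : u ≤ m := by rw [hu, hm]; exact Real.sqrt_le_sqrt hsinle
  have hm2' : m ≤ 2 := by nlinarith
  have hsin : p - Real.sin p ≤ p ^ 2 := by
    rcases le_total p 1 with h | h
    · have := Real.sin_gt_sub_cube hp0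
      nlinarith [mul_nonneg (sq_nonneg p) (by linarith : 0 ≤ 1 - p), sq_nonneg p]
    · nlinarith
  have hcube : m ^ 3 - u ^ 3 ≤ 4 * p ^ 2 := by
    have h1 : m ^ 3 - u ^ 3 ≤ (p - Real.sin p) * (m + u) := by
      rw [← hu2, ← hm2]
      have : 0 ≤ (m - u) * (m * u) := mul_nonneg (by linarith) (by positivity)
      nlinarith
    have h2 : (p - Real.sin p) * (m + u) ≤ p ^ 2 * 4 := by
      apply mul_le_mul hsin (by linarith) (by positivity) (by positivity)
    linarith
  have hcube0 : 0 ≤ m ^ 3 - u ^ 3 := by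
    have : u ^ 3 ≤ m ^ 3 := by gcongr
    linarith
  have hG : ‖(1/2 : ℂ) * ((u ^ 3 : ℝ) : ℂ) * (1 + Complex.I * ((Real.sign y : ℝ) : ℂ)) - G0 y‖ ≤ 4 * p ^ 2 := by
    rw [G0, ← hp, aux_rpow p hp0.le, ← hm]
    have e : (1/2 : ℂ) * ((u ^ 3 : ℝ) : ℂ) * (1 + Complex.I * ((Real.sign y : ℝ) : ℂ)) -
        1/2 * ((m ^ 3 : ℝ) : ℂ) * (1 + Complex.I * ((Real.sign y : ℝ) : ℂ)) =
        -((((m ^ 3 - u ^ 3) / 2 : ℝ) : ℂ) * (1 + Complex.I * ((Real.sign y : ℝ) : ℂ))) := by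
      push_cast; ring
    rw [e, norm_neg, norm_mul, Complex.norm_real, Real.norm_of_nonneg (by linarith)]
    have h2 : ‖1 + Complex.I * ((Real.sign y : ℝ) : ℂ)‖ ≤ 2 := by
      refine (norm_add_le _ _).trans ?_
      rw [norm_mul, Complex.norm_I, norm_one, Complex.norm_real]
      rcases hσ with h | h <;> rw [h] <;> norm_num
    nlinarith [mul_le_mul_of_nonneg_left h2 hcube0]
  rw [← hp, aux_rpow p hp0.le, ← hm]
  have hu3 : 152 * a * u ^ 3 ≤ 152 * a * m ^ 3 := by gcongr
  have hu4 : u ^ 4 ≤ p ^ 2 := by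
    have : u ^ 4 = (Real.sin p) ^ 2 := by rw [← hu2]; ring
    rw [this]; gcongr
  calc ‖Gn a y - G0 y‖ ≤ _ := norm_sub_le_norm_sub_add_norm_sub _
        ((1/2 : ℂ) * ((u ^ 3 : ℝ) : ℂ) * (1 + Complex.I * ((Real.sign y : ℝ) : ℂ))) _
    _ ≤ (152 * a * u ^ 3 + 189 * u ^ 4) + 4 * p ^ 2 := add_le_add hcore hG
    _ ≤ _ := by linarith

/-- `|n^{3/2} Gₙ(ξ/n) - G₀(ξ)| ≤ C(γₙ|ξ|^{3/2} + ξ²/√n)` for `ξ ∈ [-n/2, n/2]`. -/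
theorem stmt_17 (γ κ : ℕ → ℝ) (hγpos : ∀ n, 0 ≤ γ n) (hκpos : ∀ n, 0 ≤ κ n)
    (hγ : Tendsto γ atTop (nhds 0)) (hκ : Tendsto κ atTop (nhds 3)) :
    ∃ C : ℝ, 0 < C ∧ ∃ N : ℕ, ∀ n ≥ N, ∀ ξ ∈ Set.Icc (-(n : ℝ)/2) ((n : ℝ)/2),
      ‖((((n : ℝ) ^ ((3:ℝ)/2) : ℝ)) : ℂ) * Gn (κ n * γ n) (ξ / n) - G0 ξ‖
        ≤ C * (γ n * |ξ| ^ ((3:ℝ)/2) + ξ ^ 2 / Real.sqrt n) := by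
  have h1 : ∀ᶠ n in atTop, γ n ≤ 1 := hγ.eventually_le_const (by norm_num)
  have h2 : ∀ᶠ n in atTop, κ n ≤ 4 := hκ.eventually_le_const (by norm_num)
  obtain ⟨N, hN⟩ := eventually_atTop.1 ((h1.and h2).and (eventually_ge_atTop 1))
  refine ⟨5000, by norm_num, N, ?_⟩
  intro n hn ξ hξ
  obtain ⟨⟨hγ1, hκ4⟩, hn1⟩ := hN n hn
  have hnpos : (0:ℝ) < n := by exact_mod_cast hn1
  have hg0 := hγpos n
  have hk0 := hκpos n
  have ha : 0 ≤ κ n * γ n := mul_nonneg hk0 hg0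
  have haγ : κ n * γ n ≤ 4 * γ n := by gcongr
  obtain ⟨y, hy⟩ : ∃ y, y = ξ / n := ⟨_, rfl⟩
  have hξy : ξ = n * y := by rw [hy]; field_simp
  rw [← hy]
  have hy2 : |y| ≤ 1 / 2 := by
    rw [hy, abs_div, abs_of_pos hnpos, div_le_iff₀ hnpos, abs_le]
    constructor <;> linarith [hξ.1, hξ.2]
  have hmain := aux_y (κ n * γ n) y ha (by linarith) hy2
  have hGs : G0 ξ = ((((n : ℝ) ^ ((3:ℝ)/2) : ℝ)) : ℂ) * G0 y := by
    have e1 : |π * ξ| = n * |π * y| := by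
      rw [hξy, show π * (n * y) = n * (π * y) by ring, abs_mul, abs_of_pos hnpos]
    have e2 : Real.sign ξ = Real.sign y := by
      rcases lt_trichotomy y 0 with h | h | h
      · rw [Real.sign_of_neg h, Real.sign_of_neg (by rw [hξy]; exact mul_neg_of_pos_of_neg hnpos h)]
      · rw [hξy, h, mul_zero]
      · rw [Real.sign_of_pos h, Real.sign_of_pos (by rw [hξy]; positivity)]
    rw [G0, G0, e1, e2, Real.mul_rpow hnpos.le (abs_nonneg _)]
    push_cast; ring
  rw [hGs, ← mul_sub, norm_mul, Complex.norm_real, Real.norm_of_nonneg (by positivity)]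
  obtain ⟨r, hr⟩ : ∃ r, r = Real.sqrt n := ⟨_, rfl⟩
  have hr0 : 0 < r := by rw [hr]; exact Real.sqrt_pos.2 hnpos
  have hrn : (n:ℝ) = r ^ 2 := by rw [hr, Real.sq_sqrt hnpos.le]
  have hn3 : (n:ℝ) ^ ((3:ℝ)/2) = r ^ 3 := by rw [aux_rpow _ hnpos.le, ← hr]
  have hξ3 : |ξ| ^ ((3:ℝ)/2) = r ^ 3 * |y| ^ ((3:ℝ)/2) := by
    rw [hξy, abs_mul, abs_of_pos hnpos, Real.mul_rpow hnpos.le (abs_nonneg _), hn3]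
  have hξ2 : ξ ^ 2 / Real.sqrt n = r ^ 3 * y ^ 2 := by
    rw [← hr, hξy, hrn]; field_simp
  rw [hξ3, hξ2, hn3]
  have hY0 : 0 ≤ |y| ^ ((3:ℝ)/2) := by positivity
  have hp3 : |π * y| ^ ((3:ℝ)/2) ≤ 8 * |y| ^ ((3:ℝ)/2) := by
    rw [abs_mul, Real.mul_rpow (abs_nonneg _) (abs_nonneg _), abs_of_pos Real.pi_pos]
    gcongr
    rw [aux_rpow _ Real.pi_pos.le]
    have : Real.sqrt π ≤ 2 := Real.sqrt_le_iff.2 ⟨by norm_num, by linarith [Real.pi_le_four]⟩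
    calc Real.sqrt π ^ 3 ≤ 2 ^ 3 := by gcongr
      _ = 8 := by norm_num
  have hp2 : |π * y| ^ 2 ≤ 16 * y ^ 2 := by
    rw [sq_abs, mul_pow]
    gcongr
    nlinarith [Real.pi_le_four, Real.pi_pos]
  have hA : 152 * (κ n * γ n) * |π * y| ^ ((3:ℝ)/2) ≤ 152 * (4 * γ n) * (8 * |y| ^ ((3:ℝ)/2)) := by
    gcongr
  have hB : 0 ≤ γ n * |y| ^ ((3:ℝ)/2) := by positivity
  calc r ^ 3 * ‖Gn (κ n * γ n) y - G0 y‖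
      ≤ r ^ 3 * (5000 * (γ n * |y| ^ ((3:ℝ)/2) + y ^ 2)) := by
        gcongr
        linarith [sq_nonneg y]
    _ = _ := by ring
end
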